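/- Let (G,w) be a routing-connected road network and let S be a proper scope mapping of it. Then for every vertex s ∈ V(G) having an outgoing edge and every vertex t ∈ V(G) having an incoming edge, there exists an st-admissible walk in G for S from s to t. -/

import Mathlib

open scoped ENNReal
open Classical

/-- A directed multigraph: edges are abstract objects equipped with a source and
a destination vertex. -/
structure RNGraph (V : Type) (E : Type) where
  src : E → V
  dst : E → V

namespace RNGraph

variable {V E : Type}

/-- The reverse graph `G^R`: same vertices, all edges reversed. -/
def reverse (G : RNGraph V E) : RNGraph V E := ⟨G.dst, G.src⟩

/-- `G.IsWalkFrom s t P` : the list of edges `P` forms a walk from `s` to `t` in `G`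
(the zero-length walk from `s` to `s` corresponds to `P = []`). -/
def IsWalkFrom (G : RNGraph V E) : V → V → List E → Prop
  | s, t, [] => s = t
  | s, t, e :: P => G.src e = s ∧ G.IsWalkFrom (G.dst e) t P

end RNGraph

/-- The weight `|P|_w` of a walk: the sum of its edge weights (with multiplicity). -/
def wsum {E : Type} (w : E → ℝ) (P : List E) : ℝ := (P.map w).sum

/-- The turn-scope handicap `h_S(e)` of an edge `e`: the maximum among `S e` and all
`S f` over edges `f` leaving the head of `e`. -/
noncomputable def handicap {V E : Type} [Fintype E] (G : RNGraph V E) (S : E → ℕ∞)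
    (e : E) : ℕ∞ :=
  S e ⊔ (Finset.univ.filter fun f => G.src f = G.dst e).sup S

/-- The quantity bounded in condition (3) of the definition of scope admissibility:
`Σ_{f ∈ P, S f > ℓ} w f  +  Σ_{f ∈ P, h_S f > ℓ ≥ S f} κ ℓ`. -/
noncomputable def scopeCost {V E : Type} [Fintype E] (G : RNGraph V E) (w : E → ℝ)
    (S : E → ℕ∞) (κ : ℕ∞ → ℝ≥0∞) (ℓ : ℕ∞) (P : List E) : ℝ≥0∞ :=
  (P.map fun f => if ℓ < S f then ENNReal.ofReal (w f) else 0).sum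
    + (P.map fun f => if S f ≤ ℓ ∧ ℓ < handicap G S f then κ ℓ else 0).sum

/-- `Admissible G w S ν κ x A e` : the edge `e` is `x`-admissible for the scope
mapping `S` (with scope values `ν` and handicap constants `κ`) in the subgraph of
`G` given by the edge set `A`.  Following Def. 4 (Scope Admissibility), `e = (u,v)`
is `x`-admissible iff there is a walk `P ⊆ G - e` from `x` to `u` such that
(1) every edge of `P` is `x`-admissible in `G - e`, (2) `P` is of minimum weight
subject to (1), and (3) with `ℓ = S e`,
`Σ_{f ∈ P, S f > ℓ} w f + Σ_{f ∈ P, h_S f > ℓ ≥ S f} κ ℓ ≤ ν ℓ`.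
(`x`-admissibility in `G` itself is `Admissible G w S ν κ x Finset.univ e`.) -/
noncomputable def Admissible {V E : Type} [Fintype E] [DecidableEq E] (G : RNGraph V E)
    (w : E → ℝ) (S : E → ℕ∞) (ν κ : ℕ∞ → ℝ≥0∞) (x : V) (A : Finset E) (e : E) : Prop :=
  if he : e ∈ A then
    ∃ P : List E,
      G.IsWalkFrom x (G.src e) P ∧
      (∀ f ∈ P, Admissible G w S ν κ x (A.erase e) f) ∧
      (∀ Q : List E, G.IsWalkFrom x (G.src e) Q →
        (∀ f ∈ Q, Admissible G w S ν κ x (A.erase e) f) → wsum w P ≤ wsum w Q) ∧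
      scopeCost G w S κ (S e) P ≤ ν (S e)
  else False
termination_by A.card
decreasing_by all_goals exact Finset.card_erase_lt_of_mem he

/-- A walk is `s`-admissible in `G` if every edge of it is `s`-admissible in `G`. -/
def SAdmissibleWalk {V E : Type} [Fintype E] [DecidableEq E] (G : RNGraph V E)
    (w : E → ℝ) (S : E → ℕ∞) (ν κ : ℕ∞ → ℝ≥0∞) (s : V) (P : List E) : Prop :=
  ∀ e ∈ P, Admissible G w S ν κ s Finset.univ e

/-- A walk `P` from `s` to `t` is `st`-admissible in `G` if it splits as
`P = P₁ ++ P₂` where every edge of `P₁` is `s`-admissible in `G` and the reverse of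
every edge of `P₂` is `t`-admissible in the reverse graph `G^R` (in our encoding the
reverse of an edge `e` is `e` itself viewed in `G.reverse`). -/
def STAdmissibleWalk {V E : Type} [Fintype E] [DecidableEq E] (G : RNGraph V E)
    (w : E → ℝ) (S : E → ℕ∞) (ν κ : ℕ∞ → ℝ≥0∞) (s t : V) (P : List E) : Prop :=
  ∃ P₁ P₂ : List E, P = P₁ ++ P₂ ∧
    (∀ e ∈ P₁, Admissible G w S ν κ s Finset.univ e) ∧
    (∀ e ∈ P₂, Admissible G.reverse w S ν κ t Finset.univ e)

/-- `S` together with the scope values `ν` and handicap constants `κ` is a scope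
mapping: `0, ∞ ∈ Im(S)`, `0 = ν_0 < ν_1 < ⋯ < ν_∞ = ∞`, and `0 < κ_0 < ⋯ < κ_∞`
(strict monotonicity being required on the scope levels, i.e. on `Im(S)`). -/
structure IsScopeMapping {V E : Type} (G : RNGraph V E) (S : E → ℕ∞)
    (ν κ : ℕ∞ → ℝ≥0∞) : Prop where
  zero_mem : 0 ∈ Set.range S
  top_mem : ⊤ ∈ Set.range S
  ν_zero : ν 0 = 0
  ν_top : ν ⊤ = ⊤
  ν_mono : StrictMonoOn ν (Set.range S)
  κ_pos : ∀ i ∈ Set.range S, 0 < κ i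
  κ_mono : StrictMonoOn κ (Set.range S)

/-- `G` restricted to the edge set `A` is routing-connected: for every pair of
edges `e, f ∈ A` there is a walk within `A` starting with the edge `e` and ending
with the edge `f`. -/
def RoutingConnectedOn {V E : Type} (G : RNGraph V E) (A : Set E) : Prop :=
  ∀ e ∈ A, ∀ f ∈ A, ∃ P : List E, (∀ g ∈ P, g ∈ A) ∧
    G.IsWalkFrom (G.src e) (G.dst f) P ∧ P.head? = some e ∧ P.getLast? = some f

/-- A scope mapping is proper if for each scope level `i ∈ Im(S)` the subgraph
`G^[i]` induced by the edges of scope level `≥ i` is routing-connected. -/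
def ProperScope {V E : Type} (G : RNGraph V E) (S : E → ℕ∞) : Prop :=
  ∀ i ∈ Set.range S, RoutingConnectedOn G {e : E | i ≤ S e}

namespace RNGraph

variable {V E : Type}

theorem isWalkFrom_append (G : RNGraph V E) (P Q : List E) (s t : V) :
    G.IsWalkFrom s t (P ++ Q) ↔ ∃ u, G.IsWalkFrom s u P ∧ G.IsWalkFrom u t Q := by
  induction P generalizing s with
  | nil => simp [IsWalkFrom]
  | cons e P ih => simp [IsWalkFrom, ih, and_assoc]

theorem isWalkFrom_concat (G : RNGraph V E) (P : List E) (e : E) (s t : V) :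
    G.IsWalkFrom s t (P ++ [e]) ↔ G.IsWalkFrom s (G.src e) P ∧ G.dst e = t := by
  rw [isWalkFrom_append]
  constructor
  · rintro ⟨u, hP, rfl, h⟩
    exact ⟨hP, h⟩
  · rintro ⟨hP, h⟩
    exact ⟨_, hP, rfl, h⟩

theorem IsWalkFrom.reverse {G : RNGraph V E} {P : List E} {s t : V}
    (h : G.IsWalkFrom s t P) : G.reverse.IsWalkFrom t s P.reverse := by
  induction P generalizing s with
  | nil => exact Eq.symm h
  | cons e P ih =>
    rw [List.reverse_cons, isWalkFrom_concat]
    exact ⟨ih h.2, h.1⟩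

end RNGraph

section Walks

variable {V E : Type}

theorem wsum_append (w : E → ℝ) (P Q : List E) : wsum w (P ++ Q) = wsum w P + wsum w Q := by
  simp [wsum]

theorem wsum_nonneg {w : E → ℝ} (hw : ∀ e, 0 ≤ w e) (P : List E) : 0 ≤ wsum w P :=
  List.sum_nonneg (by simpa using fun e _ => hw e)

/-- Deleting closed subwalks yields a walk without repeated edges that is not heavier. -/
theorem exists_nodup_walk (G : RNGraph V E) {w : E → ℝ} (hw : ∀ e, 0 ≤ w e) (t : V)
    (Q : List E) (s : V) (hQ : G.IsWalkFrom s t Q) :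
    ∃ P : List E, P.Nodup ∧ G.IsWalkFrom s t P ∧ P ⊆ Q ∧ wsum w P ≤ wsum w Q := by
  induction Q generalizing s with
  | nil => exact ⟨[], List.nodup_nil, hQ, List.Subset.refl _, le_rfl⟩
  | cons e Q ih =>
    obtain ⟨P, hnd, hP, hsub, hle⟩ := ih _ hQ.2
    have hcons : wsum w (e :: Q) = w e + wsum w Q := by simp [wsum]
    by_cases he : e ∈ P
    · obtain ⟨a, b, rfl⟩ := List.append_of_mem he
      obtain ⟨u, -, hu⟩ := (G.isWalkFrom_append _ _ _ _).1 hP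
      refine ⟨e :: b, hnd.of_append_right, ⟨hQ.1, hu.2⟩, fun f hf => ?_, ?_⟩
      · exact List.mem_cons_of_mem _ (hsub (List.mem_append_right _ hf))
      · rw [wsum_append] at hle
        linarith [wsum_nonneg hw a, hw e]
    · refine ⟨e :: P, List.nodup_cons.2 ⟨he, hnd⟩, ⟨hQ.1, hP⟩,
        List.cons_subset_cons _ hsub, ?_⟩
      rw [hcons, show wsum w (e :: P) = w e + wsum w P by simp [wsum]]
      linarith

theorem RoutingConnectedOn.reverse {G : RNGraph V E} {A : Set E}
    (h : RoutingConnectedOn G A) : RoutingConnectedOn G.reverse A := by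
  intro e he f hf
  obtain ⟨P, hA, hP, hhead, hlast⟩ := h f hf e he
  refine ⟨P.reverse, by simpa using hA, hP.reverse, ?_, ?_⟩
  · rw [List.head?_reverse, hlast]
  · rw [List.getLast?_reverse, hhead]

end Walks

section Admissibility

variable {V E : Type} [Fintype E] [DecidableEq E] {G : RNGraph V E} {w : E → ℝ}
  {S : E → ℕ∞} {ν κ : ℕ∞ → ℝ≥0∞} {x : V}

variable (G w S ν κ x) in
/-- `P` is a walk from `x` to `v` all of whose edges are `x`-admissible in the subgraph `A`. -/
def AdmissibleWalk (A : Finset E) (v : V) (P : List E) : Prop :=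
  G.IsWalkFrom x v P ∧ ∀ f ∈ P, Admissible G w S ν κ x A f

theorem admissible_iff {A : Finset E} {e : E} :
    Admissible G w S ν κ x A e ↔ e ∈ A ∧ ∃ P,
      AdmissibleWalk G w S ν κ x (A.erase e) (G.src e) P ∧
      (∀ Q, AdmissibleWalk G w S ν κ x (A.erase e) (G.src e) Q → wsum w P ≤ wsum w Q) ∧
      scopeCost G w S κ (S e) P ≤ ν (S e) := by
  rw [Admissible]
  split_ifs with he
  · simp only [he, true_and, AdmissibleWalk, and_assoc, and_imp]
  · simp [he]

theorem admissibleWalk_concat {A : Finset E} {v : V} {P : List E} {e : E} :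
    AdmissibleWalk G w S ν κ x A v (P ++ [e]) ↔
      AdmissibleWalk G w S ν κ x A (G.src e) P ∧ Admissible G w S ν κ x A e ∧ G.dst e = v := by
  simp only [AdmissibleWalk, RNGraph.isWalkFrom_concat, List.mem_append, List.mem_singleton,
    or_imp, forall_and, forall_eq]
  tauto

theorem exists_min_admissibleWalk (hw : ∀ e, 0 ≤ w e) {A : Finset E} {v : V}
    (h : ∃ Q, AdmissibleWalk G w S ν κ x A v Q) :
    ∃ P, AdmissibleWalk G w S ν κ x A v P ∧
      ∀ Q, AdmissibleWalk G w S ν κ x A v Q → wsum w P ≤ wsum w Q := by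
  have trim : ∀ Q, AdmissibleWalk G w S ν κ x A v Q →
      ∃ P : {l : List E // l.Nodup}, AdmissibleWalk G w S ν κ x A v P.1 ∧
        wsum w P.1 ≤ wsum w Q := by
    intro Q hQ
    obtain ⟨P, hnd, hP, hsub, hle⟩ := exists_nodup_walk G hw v Q x hQ.1
    exact ⟨⟨P, hnd⟩, ⟨hP, fun f hf => hQ.2 f (hsub hf)⟩, hle⟩
  obtain ⟨Q, hQ⟩ := h
  obtain ⟨P₀, hP₀, -⟩ := trim Q hQ
  obtain ⟨P, hP, hmin⟩ := Set.exists_min_image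
    {P : {l : List E // l.Nodup} | AdmissibleWalk G w S ν κ x A v P.1}
    (fun P => wsum w P.1) (Set.toFinite _) ⟨P₀, hP₀⟩
  refine ⟨P.1, hP, fun R hR => ?_⟩
  obtain ⟨R', hR', hle⟩ := trim R hR
  exact (hmin R' hR').trans hle

/-- Removing an edge `e` does not affect the admissible walks that are strictly shorter than the
admissible distance of the tail of `e`, and restoring `e` preserves the admissible walks that are
at most as long as this distance. -/
theorem admissibleWalk_erase (hw : ∀ e, 0 ≤ w e) (A : Finset E) :
    ∀ e ∈ A, ∀ r : ℝ,
      ((∀ P, AdmissibleWalk G w S ν κ x (A.erase e) (G.src e) P → r < wsum w P) →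
        ∀ v Q, wsum w Q ≤ r → (AdmissibleWalk G w S ν κ x A v Q ↔
          AdmissibleWalk G w S ν κ x (A.erase e) v Q)) ∧
      ((∀ P, AdmissibleWalk G w S ν κ x (A.erase e) (G.src e) P → r ≤ wsum w P) →
        ∀ v Q, wsum w Q ≤ r → AdmissibleWalk G w S ν κ x (A.erase e) v Q →
          AdmissibleWalk G w S ν κ x A v Q) := by
  induction A using Finset.strongInduction with
  | H A IH =>
  intro e he r
  have init_le : ∀ (Q : List E) (f : E), wsum w (Q ++ [f]) ≤ r → wsum w Q ≤ r := by
    intro Q f h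
    rw [wsum_append] at h
    linarith [wsum_nonneg hw [f]]
  have dist_le : ∀ f ∈ A.erase e, ∀ P₀,
      (∀ P, AdmissibleWalk G w S ν κ x ((A.erase e).erase f) (G.src f) P →
        wsum w P₀ ≤ wsum w P) →
      ∀ Q, AdmissibleWalk G w S ν κ x (A.erase e) (G.src f) Q → wsum w P₀ ≤ wsum w Q := by
    intro f hf P₀ hmin Q hQ
    by_contra! hlt
    have := ((IH _ (Finset.erase_ssubset he) f hf (wsum w Q)).1
      (fun P hP => hlt.trans_le (hmin P hP)) _ Q le_rfl).1 hQ
    linarith [hmin Q this]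
  constructor
  · intro H
    have edge : ∀ f ∈ A.erase e, ∀ Q, AdmissibleWalk G w S ν κ x (A.erase e) (G.src f) Q →
        wsum w Q ≤ r →
        (Admissible G w S ν κ x A f ↔ Admissible G w S ν κ x (A.erase e) f) := by
      intro f hf Q hQ hQr
      obtain ⟨hfe, hfA⟩ := Finset.mem_erase.1 hf
      have heA : e ∈ A.erase f := Finset.mem_erase.2 ⟨hfe.symm, he⟩
      have IH₁ := IH _ (Finset.erase_ssubset he) f hf
      have IH₂ := IH _ (Finset.erase_ssubset hfA) e heA
      rw [Finset.erase_right_comm] at IH₂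
      obtain ⟨P₀, hP₀, hmin⟩ := exists_min_admissibleWalk (G := G) (S := S) (ν := ν) (κ := κ)
        (x := x) hw (A := (A.erase e).erase f) (v := G.src f) (by
          by_contra! hno
          exact hno Q (((IH₁ (wsum w Q)).1 (fun P hP => (hno P hP).elim) _ Q le_rfl).1 hQ))
      have hP₀r : wsum w P₀ ≤ r := (dist_le f hf P₀ hmin Q hQ).trans hQr
      have same := (IH₂ (wsum w P₀)).1 (fun P hP => by
        by_contra! hle
        have := H P ((IH₁ (wsum w P₀)).2 hmin _ P hle hP)
        linarith)
      rw [admissible_iff, admissible_iff]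
      simp only [hf, hfA, true_and]
      constructor
      · rintro ⟨P, hP, hPmin, hc⟩
        have hle : wsum w P ≤ wsum w P₀ := hPmin _ ((same _ _ le_rfl).2 hP₀)
        exact ⟨P, (same _ _ hle).1 hP, fun R hR => hle.trans (hmin R hR), hc⟩
      · rintro ⟨P, hP, hPmin, hc⟩
        have hle : wsum w P ≤ wsum w P₀ := hPmin _ hP₀
        refine ⟨P, (same _ _ hle).2 hP, fun R hR => ?_, hc⟩
        by_contra! hlt
        linarith [hPmin R ((same _ R (by linarith)).1 hR)]
    intro v Q
    induction Q using List.reverseRecOn generalizing v with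
    | nil => intro _; simp [AdmissibleWalk]
    | append_singleton Q f ihQ =>
      intro hr
      have hQr := init_le Q f hr
      rw [admissibleWalk_concat, admissibleWalk_concat, ihQ _ hQr]
      refine and_congr_right fun hQ => and_congr_left fun _ => ?_
      have hfe : f ≠ e := by
        rintro rfl
        linarith [H Q hQ]
      by_cases hfA : f ∈ A
      · exact edge f (Finset.mem_erase.2 ⟨hfe, hfA⟩) Q hQ hQr
      · rw [admissible_iff, admissible_iff]
        simp [hfA]
  · intro H
    have edge : ∀ f ∈ A.erase e, ∀ Q, AdmissibleWalk G w S ν κ x (A.erase e) (G.src f) Q →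
        wsum w Q ≤ r →
        Admissible G w S ν κ x (A.erase e) f → Admissible G w S ν κ x A f := by
      intro f hf Q hQ hQr hadm
      obtain ⟨hfe, hfA⟩ := Finset.mem_erase.1 hf
      have heA : e ∈ A.erase f := Finset.mem_erase.2 ⟨hfe.symm, he⟩
      have IH₁ := IH _ (Finset.erase_ssubset he) f hf
      have IH₂ := IH _ (Finset.erase_ssubset hfA) e heA
      rw [Finset.erase_right_comm] at IH₂
      obtain ⟨-, P, hP, hmin, hc⟩ := admissible_iff.1 hadm
      have hPr : wsum w P ≤ r := (dist_le f hf P hmin Q hQ).trans hQr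
      have far : ∀ R, AdmissibleWalk G w S ν κ x ((A.erase e).erase f) (G.src e) R →
          wsum w P ≤ wsum w R := by
        intro R hR
        by_contra! hlt
        have := H R (((IH₁ (wsum w R)).1 (fun R' hR' => hlt.trans_le (hmin R' hR'))
          _ R le_rfl).2 hR)
        linarith
      refine admissible_iff.2 ⟨hfA, P, (IH₂ _).2 far _ P le_rfl hP, fun R hR => ?_, hc⟩
      by_contra! hlt
      have := ((IH₂ (wsum w R)).1 (fun R' hR' => hlt.trans_le (far R' hR')) _ R le_rfl).1 hR
      linarith [hmin R this]
    intro v Q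
    induction Q using List.reverseRecOn generalizing v with
    | nil => intro _ h; exact ⟨h.1, by simp⟩
    | append_singleton Q f ihQ =>
      intro hr
      have hQr := init_le Q f hr
      rw [admissibleWalk_concat, admissibleWalk_concat]
      rintro ⟨hQ, hf, hv⟩
      exact ⟨ihQ _ hQr hQ, edge f (admissible_iff.1 hf).1 Q hQ hQr hf, hv⟩

variable (G w S ν κ x) in
/-- The vertices that can be reached from `x` by an `x`-admissible walk in `G`. -/
def AdmissiblyReachable (v : V) : Prop :=
  ∃ P, AdmissibleWalk G w S ν κ x Finset.univ v P

theorem AdmissibleWalk.reachable_src {v : V} {P : List E}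
    (hP : AdmissibleWalk G w S ν κ x Finset.univ v P) {f : E} (hf : f ∈ P) :
    AdmissiblyReachable G w S ν κ x (G.src f) ∧ AdmissiblyReachable G w S ν κ x (G.dst f) := by
  obtain ⟨a, b, rfl⟩ := List.append_of_mem hf
  obtain ⟨u, hu, rfl, -⟩ := (G.isWalkFrom_append _ _ _ _).1 hP.1
  have ha : AdmissibleWalk G w S ν κ x Finset.univ (G.src f) a :=
    ⟨hu, fun g hg => hP.2 g (List.mem_append_left _ hg)⟩
  exact ⟨⟨a, ha⟩, ⟨a ++ [f], admissibleWalk_concat.2 ⟨ha, hP.2 f hf, rfl⟩⟩⟩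

theorem scopeCost_eq_zero {ℓ : ℕ∞} {P : List E} (h : ∀ f ∈ P, handicap G S f ≤ ℓ) :
    scopeCost G w S κ ℓ P = 0 := by
  have hS : ∀ f ∈ P, S f ≤ ℓ := fun f hf => le_sup_left.trans (h f hf)
  unfold scopeCost
  rw [List.sum_eq_zero, List.sum_eq_zero, add_zero]
  · simp only [List.mem_map]
    rintro _ ⟨f, hf, rfl⟩
    rw [if_neg fun hlt => (h f hf).not_gt hlt.2]
  · simp only [List.mem_map]
    rintro _ ⟨f, hf, rfl⟩
    rw [if_neg (hS f hf).not_gt]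

/-- An edge of the largest scope among those leaving reachable vertices is admissible. -/
theorem admissible_of_scope_max (hw : ∀ e, 0 ≤ w e) {e : E}
    (he : AdmissiblyReachable G w S ν κ x (G.src e))
    (hmax : ∀ f, AdmissiblyReachable G w S ν κ x (G.src f) → S f ≤ S e) :
    Admissible G w S ν κ x Finset.univ e := by
  have key := admissibleWalk_erase (G := G) (S := S) (ν := ν) (κ := κ) (x := x) hw
    Finset.univ e (Finset.mem_univ e)
  obtain ⟨P, hP, hmin⟩ := exists_min_admissibleWalk (G := G) (S := S) (ν := ν) (κ := κ)
    (x := x) hw (A := Finset.univ.erase e) (v := G.src e) (by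
      obtain ⟨Q, hQ⟩ := he
      by_contra! hno
      exact hno Q (((key (wsum w Q)).1 (fun P hP => (hno P hP).elim) _ Q le_rfl).1 hQ))
  have hP' := (key (wsum w P)).2 hmin _ P le_rfl hP
  refine admissible_iff.2 ⟨Finset.mem_univ e, P, hP, hmin, ?_⟩
  rw [scopeCost_eq_zero fun f hf => ?_]
  · exact zero_le
  · obtain ⟨h₁, h₂⟩ := hP'.reachable_src hf
    refine sup_le (hmax f h₁) (Finset.sup_le fun g hg => hmax g ?_)
    rw [(Finset.mem_filter.1 hg).2]
    exact h₂

theorem admissiblyReachable_of_scope_top (hw : ∀ e, 0 ≤ w e) (hproper : ProperScope G S)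
    (hx : ∃ e, G.src e = x) {g : E} (hg : S g = ⊤) :
    AdmissiblyReachable G w S ν κ x (G.src g) ∧ AdmissiblyReachable G w S ν κ x (G.dst g) := by
  obtain ⟨e₀, rfl⟩ := hx
  obtain ⟨e, he, hmax⟩ := Set.exists_max_image
    {f : E | AdmissiblyReachable G w S ν κ (G.src e₀) (G.src f)} S (Set.toFinite _)
    ⟨e₀, [], rfl, by simp⟩
  have walk : ∀ (Q : List E) (u v : V), (∀ f ∈ Q, S e ≤ S f) → G.IsWalkFrom u v Q →
      AdmissiblyReachable G w S ν κ (G.src e₀) u → ∀ f ∈ Q,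
        AdmissiblyReachable G w S ν κ (G.src e₀) (G.src f) ∧
        AdmissiblyReachable G w S ν κ (G.src e₀) (G.dst f) := by
    intro Q
    induction Q with
    | nil => simp
    | cons f Q ih =>
      rintro u v hle ⟨rfl, hQ⟩ hu
      have hadm : Admissible G w S ν κ (G.src e₀) Finset.univ f :=
        admissible_of_scope_max hw hu fun f' hf' => (hmax f' hf').trans (hle f (by simp))
      have hdst : AdmissiblyReachable G w S ν κ (G.src e₀) (G.dst f) := by
        obtain ⟨P, hP⟩ := hu
        exact ⟨P ++ [f], admissibleWalk_concat.2 ⟨hP, hadm, rfl⟩⟩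
      intro f' hf'
      rcases List.mem_cons.1 hf' with rfl | hf'
      · exact ⟨hu, hdst⟩
      · exact ih _ v (fun h hh => hle h (List.mem_cons_of_mem _ hh)) hQ hdst f' hf'
  obtain ⟨Q, hQ, hQw, -, hlast⟩ := hproper (S e) ⟨e, rfl⟩ e (le_refl (S e)) g
    (show S e ≤ S g by simp [hg])
  exact walk Q _ _ hQ hQw he g (List.mem_of_getLast? hlast)

end Admissibility

/-- Let `(G,w)` be a routing-connected road network and `S` a proper
scope mapping of it. Then for every vertex `s` having an outgoing edge and every vertex
`t` having an incoming edge there exists an `st`-admissible walk in `G` for `S`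
from `s` to `t`. -/
theorem exists_st_admissible_walk {V E : Type} [Fintype E] [DecidableEq E]
    (G : RNGraph V E) (w : E → ℝ) (hw : ∀ e, 0 ≤ w e)
    (S : E → ℕ∞) (ν κ : ℕ∞ → ℝ≥0∞) (hS : IsScopeMapping G S ν κ)
    (hconn : RoutingConnectedOn G Set.univ)
    (hproper : ProperScope G S)
    (s t : V) (hs : ∃ e, G.src e = s) (ht : ∃ f, G.dst f = t) :
    ∃ P : List E, G.IsWalkFrom s t P ∧ STAdmissibleWalk G w S ν κ s t P := by
  obtain ⟨g, hg⟩ := hS.top_mem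
  have hproper' : ProperScope G.reverse S := fun i hi => (hproper i hi).reverse
  obtain ⟨-, P, hP, hPadm⟩ := admissiblyReachable_of_scope_top (ν := ν) (κ := κ) hw hproper hs hg
  obtain ⟨⟨Q, hQ, hQadm⟩, -⟩ :=
    admissiblyReachable_of_scope_top (ν := ν) (κ := κ) hw hproper' ht hg
  refine ⟨P ++ Q.reverse, (G.isWalkFrom_append _ _ _ _).2 ⟨_, hP, hQ.reverse⟩,
    P, Q.reverse, rfl, hPadm, ?_⟩
  simpa using hQadm
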